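/- Let {T_n}_{n≥1} be a d-decaying Gauss-like iterated function system. For every s > 1/d, the limit P(s) = lim_{n→∞} P_n(s) exists and is finite, where P_n(s) = (1/n) log Σ_{ω∈ℕ^n} |C[ω]|^s. -/

import Mathlib

open Set Filter Topology Metric MeasureTheory

noncomputable section

/-- The composition `T_{a_1} ∘ ⋯ ∘ T_{a_n}` of the maps along the word `ω = (a_1,…,a_n)`. -/
def chainMap (T : ℕ+ → ℝ → ℝ) {n : ℕ} (ω : Fin n → ℕ+) (x : ℝ) : ℝ :=
  (List.ofFn ω).foldr (fun i y => T i y) x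

/-- The chain-rule derivative of `chainMap T ω` at `x`, computed from the candidate
derivatives `T'` of the individual maps:
`(T_{a_1} ∘ ⋯ ∘ T_{a_n})'(x) = ∏_j T'_{a_j}(T_{a_{j+1}} ∘ ⋯ ∘ T_{a_n}(x))`. -/
def chainDeriv (T T' : ℕ+ → ℝ → ℝ) {n : ℕ} (ω : Fin n → ℕ+) (x : ℝ) : ℝ :=
  ((List.ofFn ω).foldr (fun i p => (T i p.1, T' i p.1 * p.2)) (x, (1 : ℝ))).2

/-- A `d`-decaying Gauss-like iterated function system: a family `{T_i}_{i ≥ 1}` of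
`C¹` self-maps of `[0,1]` (with derivative `T'`) satisfying the conditions (i)–(v). -/
structure GaussLikeIFS (d : ℝ) where
  one_lt_d : 1 < d
  T : ℕ+ → ℝ → ℝ
  T' : ℕ+ → ℝ → ℝ
  maps_to : ∀ i, Set.MapsTo (T i) (Set.Icc (0 : ℝ) 1) (Set.Icc (0 : ℝ) 1)
  hasDeriv : ∀ i, ∀ x ∈ Set.Icc (0 : ℝ) 1,
    HasDerivWithinAt (T i) (T' i x) (Set.Icc (0 : ℝ) 1) x
  derivCont : ∀ i, ContinuousOn (T' i) (Set.Icc (0 : ℝ) 1)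
  open_set_cond : ∀ i j : ℕ+, i ≠ j →
    T i '' Set.Ioo (0 : ℝ) 1 ∩ T j '' Set.Ioo (0 : ℝ) 1 = ∅
  covers : (⋃ i : ℕ+, T i '' Set.Icc (0 : ℝ) 1) = Set.Ico (0 : ℝ) 1
  ordered : ∀ i j : ℕ+, (∀ x ∈ Set.Ioo (0 : ℝ) 1, T i x < T j x) → i < j
  contracting : ∃ (m : ℕ) (h : ℝ), 0 < m ∧ 0 < h ∧ h < 1 ∧
    ∀ (a : Fin m → ℕ+), ∀ x ∈ Set.Icc (0 : ℝ) 1,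
      0 < |chainDeriv T T' a x| ∧ |chainDeriv T T' a x| ≤ h
  decay : ∀ ε : ℝ, 0 < ε → ∃ K₁ K₂ : ℝ, 0 < K₁ ∧ 0 < K₂ ∧
    ∀ i : ℕ+, ∃ ζ lam : ℝ,
      (∀ x ∈ Set.Icc (0 : ℝ) 1, ζ ≤ |T' i x| ∧ |T' i x| ≤ lam) ∧
      K₁ * ((i : ℕ) : ℝ) ^ (-(d + ε)) ≤ ζ ∧ ζ ≤ lam ∧
      lam ≤ K₂ * ((i : ℕ) : ℝ) ^ (-(d - ε))

namespace GaussLikeIFS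

variable {d : ℝ}

/-- The `n`-th level cylinder `C[ω] = T_{a_1} ∘ ⋯ ∘ T_{a_n}([0,1])`. -/
def cyl (S : GaussLikeIFS d) {n : ℕ} (ω : Fin n → ℕ+) : Set ℝ :=
  chainMap S.T ω '' Set.Icc 0 1

/-- The partition function `Z_n(s) = Σ_{ω ∈ ℕ^n} |C[ω]|^s`. -/
def Z (S : GaussLikeIFS d) (n : ℕ) (s : ℝ) : ℝ :=
  ∑' ω : Fin n → ℕ+, Metric.diam (S.cyl ω) ^ s

/-- `P_n(s) = (1/n) log Z_n(s)`. -/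
def Pn (S : GaussLikeIFS d) (n : ℕ) (s : ℝ) : ℝ :=
  (1 / (n : ℝ)) * Real.log (S.Z n s)

/-- The restricted partition function `Z_{M,n}(s) = Σ_{ω ∈ {1,…,M}^n} |C[ω]|^s`. -/
def ZM (S : GaussLikeIFS d) (M n : ℕ) (s : ℝ) : ℝ :=
  ∑' ω : {f : Fin n → ℕ+ // ∀ j, (f j : ℕ) ≤ M}, Metric.diam (S.cyl ω.1) ^ s

/-- `P_{M,n}(s) = (1/n) log Z_{M,n}(s)`. -/
def PMn (S : GaussLikeIFS d) (M n : ℕ) (s : ℝ) : ℝ :=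
  (1 / (n : ℝ)) * Real.log (S.ZM M n s)

/-- The set `E` of points of `[0,1]` admitting a symbolic expansion `a` such that
`∏_{m=1}^k a_{n+i_m}(x)^{t_m} ≥ B^n` for infinitely many `n`.
(Digits are indexed from `0` here, i.e. `a j` is the `(j+1)`-st digit.) -/
def Eset (S : GaussLikeIFS d) (B : ℝ) {k : ℕ} (i : Fin k → ℕ) (t : Fin k → ℝ) : Set ℝ :=
  {x | x ∈ Set.Icc (0 : ℝ) 1 ∧ ∃ a : ℕ → ℕ+,
    (∀ n : ℕ, x ∈ S.cyl (fun j : Fin n => a j.val)) ∧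
    (∃ᶠ n in Filter.atTop, B ^ n ≤ ∏ m, ((a (n + i m) : ℕ) : ℝ) ^ (t m))}

end GaussLikeIFS

/-- The simplex `S = {b : b_i ≥ 0, Σ b_i t_i = 1}`. -/
def simplexS {k : ℕ} (t : Fin k → ℝ) : Set (Fin k → ℝ) :=
  {b | (∀ i, 0 ≤ b i) ∧ ∑ i, b i * t i = 1}

/-- `A_m(b,s) = (d-1)·s·b_m + (d·s-1)·Σ_{j<m} b_j`. -/
def Am (d : ℝ) {k : ℕ} (b : Fin k → ℝ) (s : ℝ) (m : Fin k) : ℝ :=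
  (d - 1) * s * b m + (d * s - 1) * ∑ j ∈ Finset.Iio m, b j

/-- `A(b,s) = max_{1 ≤ m ≤ k} A_m(b,s)`. -/
def Afun (d : ℝ) {k : ℕ} (b : Fin k → ℝ) (s : ℝ) : ℝ :=
  ⨆ m, Am d b s m

/-- `A(s) = min_{b ∈ S} A(b,s)`. -/
def AS (d : ℝ) {k : ℕ} (t : Fin k → ℝ) (s : ℝ) : ℝ :=
  sInf ((fun b => Afun d b s) '' simplexS t)

namespace GaussLikeIFS

variable {d : ℝ} (S : GaussLikeIFS d)

/-- The composition of the maps along a word, given as a list. -/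
def wordMap (l : List ℕ+) (x : ℝ) : ℝ := l.foldr (fun i y => S.T i y) x

/-- The derivative of `wordMap` given by the chain rule. -/
def wordDeriv : List ℕ+ → ℝ → ℝ
  | [], _ => 1
  | i :: l, x => S.T' i (S.wordMap l x) * wordDeriv l x

@[simp] lemma wordMap_cons (i : ℕ+) (l : List ℕ+) (x : ℝ) :
    S.wordMap (i :: l) x = S.T i (S.wordMap l x) := rfl

@[simp] lemma wordDeriv_cons (i : ℕ+) (l : List ℕ+) (x : ℝ) :
    S.wordDeriv (i :: l) x = S.T' i (S.wordMap l x) * S.wordDeriv l x := rfl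

lemma foldr_eq_wordMap_wordDeriv (l : List ℕ+) (x : ℝ) :
    l.foldr (fun i p => (S.T i p.1, S.T' i p.1 * p.2)) (x, (1 : ℝ)) =
      (S.wordMap l x, S.wordDeriv l x) := by
  induction l with
  | nil => rfl
  | cons i l ih => rw [List.foldr_cons, ih]; rfl

lemma chainDeriv_eq_wordDeriv {n : ℕ} (ω : Fin n → ℕ+) (x : ℝ) :
    chainDeriv S.T S.T' ω x = S.wordDeriv (List.ofFn ω) x := by
  rw [chainDeriv, foldr_eq_wordMap_wordDeriv]

lemma wordMap_append (l l' : List ℕ+) (x : ℝ) :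
    S.wordMap (l ++ l') x = S.wordMap l (S.wordMap l' x) :=
  List.foldr_append

lemma wordDeriv_append (l l' : List ℕ+) (x : ℝ) :
    S.wordDeriv (l ++ l') x = S.wordDeriv l (S.wordMap l' x) * S.wordDeriv l' x := by
  induction l with
  | nil => simp [wordDeriv]
  | cons i l ih => simp [ih, wordMap_append, mul_assoc]

lemma wordMap_mem (l : List ℕ+) {x : ℝ} (hx : x ∈ Icc (0 : ℝ) 1) :
    S.wordMap l x ∈ Icc (0 : ℝ) 1 := by
  induction l with
  | nil => exact hx
  | cons i l ih => exact S.maps_to i ih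

lemma hasDerivWithinAt_wordMap (l : List ℕ+) {x : ℝ} (hx : x ∈ Icc (0 : ℝ) 1) :
    HasDerivWithinAt (S.wordMap l) (S.wordDeriv l x) (Icc 0 1) x := by
  induction l with
  | nil => exact hasDerivWithinAt_id _ _
  | cons i l ih =>
    exact (S.hasDeriv i _ (S.wordMap_mem l hx)).comp x ih fun y hy => S.wordMap_mem l hy

lemma exists_deriv_bounds {ε : ℝ} (hε : 0 < ε) :
    ∃ K₁ K₂ : ℝ, 0 < K₁ ∧ 0 < K₂ ∧ ∀ i : ℕ+, ∀ x ∈ Icc (0 : ℝ) 1,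
      K₁ * (i : ℝ) ^ (-(d + ε)) ≤ |S.T' i x| ∧ |S.T' i x| ≤ K₂ * (i : ℝ) ^ (-(d - ε)) := by
  obtain ⟨K₁, K₂, h₁, h₂, h⟩ := S.decay ε hε
  refine ⟨K₁, K₂, h₁, h₂, fun i x hx => ?_⟩
  obtain ⟨ζ, lam, hb, hζ, -, hlam⟩ := h i
  exact ⟨hζ.trans (hb x hx).1, (hb x hx).2.trans hlam⟩

lemma one_le_cast (i : ℕ+) : (1 : ℝ) ≤ i := by exact_mod_cast (one_le : 1 ≤ i)

lemma exists_deriv_le : ∃ Λ : ℝ, 1 ≤ Λ ∧ ∀ i : ℕ+, ∀ x ∈ Icc (0 : ℝ) 1, |S.T' i x| ≤ Λ := by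
  obtain ⟨_, K, -, -, h⟩ := S.exists_deriv_bounds (zero_lt_one.trans S.one_lt_d)
  refine ⟨max 1 K, le_max_left _ _, fun i x hx => ((h i x hx).2.trans ?_).trans (le_max_right _ _)⟩
  simp

lemma abs_deriv_pos (i : ℕ+) {x : ℝ} (hx : x ∈ Icc (0 : ℝ) 1) : 0 < |S.T' i x| := by
  obtain ⟨K, _, hK, -, h⟩ := S.exists_deriv_bounds zero_lt_one
  have := one_le_cast i
  exact lt_of_lt_of_le (by positivity) (h i x hx).1

lemma exists_deriv_ratio_le {ε : ℝ} (hε : 0 < ε) :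
    ∃ B : ℝ, 1 ≤ B ∧ ∀ i : ℕ+, ∀ x ∈ Icc (0 : ℝ) 1, ∀ y ∈ Icc (0 : ℝ) 1,
      |S.T' i x| ≤ B * (i : ℝ) ^ ε * |S.T' i y| := by
  obtain ⟨K₁, K₂, h₁, h₂, h⟩ := S.exists_deriv_bounds (half_pos hε)
  refine ⟨max 1 (K₂ / K₁), le_max_left _ _, fun i x hx y hy => ?_⟩
  have hi : (0 : ℝ) < i := zero_lt_one.trans_le (one_le_cast i)
  calc |S.T' i x| ≤ K₂ * (i : ℝ) ^ (-(d - ε / 2)) := (h i x hx).2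
    _ = K₂ / K₁ * (i : ℝ) ^ ε * (K₁ * (i : ℝ) ^ (-(d + ε / 2))) := by
        rw [show -(d - ε / 2) = ε + -(d + ε / 2) by ring, Real.rpow_add hi]
        field_simp
    _ ≤ max 1 (K₂ / K₁) * (i : ℝ) ^ ε * |S.T' i y| := by
        gcongr
        · exact le_max_right _ _
        · exact (h i y hy).1

lemma eventually_deriv_ratio_le (i : ℕ+) {B : ℝ} (hB : 1 < B) :
    ∀ᶠ r in 𝓝[>] (0 : ℝ), ∀ x ∈ Icc (0 : ℝ) 1, ∀ y ∈ Icc (0 : ℝ) 1, |x - y| < r →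
      |S.T' i x| ≤ B * |S.T' i y| := by
  have hc : ContinuousOn (fun x => |S.T' i x|) (Icc 0 1) := (S.derivCont i).abs
  obtain ⟨z, hz, hmin⟩ := isCompact_Icc.exists_isMinOn (nonempty_Icc.2 zero_le_one) hc
  have hpos := S.abs_deriv_pos i hz
  obtain ⟨r, hr, hunif⟩ := Metric.uniformContinuousOn_iff.1
    (isCompact_Icc.uniformContinuousOn_of_continuous hc) ((B - 1) * |S.T' i z|)
    (mul_pos (by linarith) hpos)
  filter_upwards [Ioo_mem_nhdsGT hr] with r' hr' x hx y hy hxy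
  have h1 := hunif x hx y hy (hxy.trans hr'.2)
  rw [Real.dist_eq] at h1
  have h2 : |S.T' i z| ≤ |S.T' i y| := hmin hy
  nlinarith [le_abs_self (|S.T' i x| - |S.T' i y|)]

lemma exists_radius_deriv_ratio_le {ε B : ℝ} (hε : 0 < ε) (hB : 1 < B) :
    ∃ r : ℝ, 0 < r ∧ ∀ i : ℕ+, ∀ x ∈ Icc (0 : ℝ) 1, ∀ y ∈ Icc (0 : ℝ) 1, |x - y| < r →
      |S.T' i x| ≤ B * (i : ℝ) ^ ε * |S.T' i y| := by
  obtain ⟨B', hB', h⟩ := S.exists_deriv_ratio_le (half_pos hε)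
  obtain ⟨M, hM⟩ := eventually_atTop.1 (((tendsto_rpow_atTop (half_pos hε)).comp
    tendsto_natCast_atTop_atTop).eventually_ge_atTop B')
  have hfin : {i : ℕ+ | (i : ℕ) < M}.Finite :=
    (Set.finite_Iio M).preimage PNat.coe_injective.injOn
  obtain ⟨r, hr, hr0⟩ := (((Filter.eventually_all_finite hfin).2
    fun i _ => S.eventually_deriv_ratio_le i hB).and self_mem_nhdsWithin).exists
  refine ⟨r, hr0, fun i x hx y hy hxy => ?_⟩
  have hi := one_le_cast i
  have hi0 : (0 : ℝ) < i := by linarith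
  rcases lt_or_ge (i : ℕ) M with hiM | hiM
  · refine (hr i hiM x hx y hy hxy).trans ?_
    gcongr
    exact le_mul_of_one_le_right (by linarith) (Real.one_le_rpow hi hε.le)
  · refine (h i x hx y hy).trans ?_
    refine mul_le_mul_of_nonneg_right ?_ (abs_nonneg _)
    have h3 : B' ≤ (i : ℝ) ^ (ε / 2) := hM i hiM
    calc B' * (i : ℝ) ^ (ε / 2) ≤ (i : ℝ) ^ (ε / 2) * (i : ℝ) ^ (ε / 2) := by gcongr
      _ = (i : ℝ) ^ ε := by rw [← Real.rpow_add hi0, add_halves]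
      _ ≤ B * (i : ℝ) ^ ε := le_mul_of_one_le_left (by positivity) hB.le

lemma abs_wordDeriv_le_pow {Λ : ℝ} (h1 : 1 ≤ Λ)
    (h : ∀ i : ℕ+, ∀ x ∈ Icc (0 : ℝ) 1, |S.T' i x| ≤ Λ) (l : List ℕ+) {x : ℝ}
    (hx : x ∈ Icc (0 : ℝ) 1) : |S.wordDeriv l x| ≤ Λ ^ l.length := by
  induction l with
  | nil => simp [wordDeriv]
  | cons i l ih =>
    rw [wordDeriv_cons, abs_mul, List.length_cons, pow_succ']
    have := h i _ (S.wordMap_mem l hx)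
    gcongr

lemma exists_abs_wordDeriv_le {r : ℝ} (hr : 0 < r) :
    ∃ N : ℕ, ∀ l : List ℕ+, N ≤ l.length → ∀ x ∈ Icc (0 : ℝ) 1, |S.wordDeriv l x| ≤ r := by
  obtain ⟨Λ, hΛ, hle⟩ := S.exists_deriv_le
  obtain ⟨m, h, hm, h0, h1, hc⟩ := S.contracting
  have key : ∀ l : List ℕ+, ∀ x ∈ Icc (0 : ℝ) 1,
      |S.wordDeriv l x| ≤ Λ ^ m * h ^ (l.length / m) := by
    intro l
    induction hn : l.length using Nat.strong_induction_on generalizing l with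
    | _ n ih =>
      intro x hx
      rcases lt_or_ge n m with hnm | hnm
      · rw [Nat.div_eq_of_lt hnm, pow_zero, mul_one]
        refine (S.abs_wordDeriv_le_pow hΛ hle l hx).trans ?_
        exact pow_le_pow_right₀ hΛ (by omega)
      · have hlen : (l.take m).length = m := by simp; omega
        have e : List.ofFn (fun j : Fin m => (l.take m).get (j.cast hlen.symm)) = l.take m := by
          rw [← List.ofFn_congr hlen, List.ofFn_get]
        have hd := ih (l.drop m).length (by simp; omega) (l.drop m) rfl x hx
        rw [List.length_drop, hn] at hd
        have ht := (hc (fun j : Fin m => (l.take m).get (j.cast hlen.symm)) _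
          (S.wordMap_mem (l.drop m) hx)).2
        rw [chainDeriv_eq_wordDeriv, e] at ht
        rw [← List.take_append_drop m l, wordDeriv_append, abs_mul, Nat.div_eq_sub_div hm hnm,
          pow_succ]
        calc _ ≤ h * (Λ ^ m * h ^ ((n - m) / m)) := by gcongr
          _ = _ := by ring
  obtain ⟨k, hk⟩ := exists_pow_lt_of_lt_one (div_pos hr (pow_pos (zero_lt_one.trans_le hΛ) m)) h1
  refine ⟨m * k, fun l hl x hx => (key l x hx).trans ?_⟩
  rw [lt_div_iff₀' (by positivity)] at hk
  refine le_trans (mul_le_mul_of_nonneg_left ?_ (by positivity)) hk.le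
  exact pow_le_pow_of_le_one h0.le h1.le ((Nat.le_div_iff_mul_le hm).2 (by rwa [mul_comm]))

lemma abs_wordMap_sub_le {l : List ℕ+} {C : ℝ}
    (h : ∀ x ∈ Icc (0 : ℝ) 1, |S.wordDeriv l x| ≤ C) {x y : ℝ}
    (hx : x ∈ Icc (0 : ℝ) 1) (hy : y ∈ Icc (0 : ℝ) 1) :
    |S.wordMap l x - S.wordMap l y| ≤ C * |x - y| :=
  Convex.norm_image_sub_le_of_norm_hasDerivWithin_le
    (fun _ hz => S.hasDerivWithinAt_wordMap l hz) h (convex_Icc 0 1) hy hx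

/-- Subexponential distortion: up to an arbitrarily small power of the product of the digits, the
derivative along a word oscillates by at most an arbitrarily small exponential factor. -/
lemma exists_wordDeriv_ratio_le {ε B : ℝ} (hε : 0 < ε) (hB : 1 < B) :
    ∃ C : ℝ, 0 < C ∧ ∀ l : List ℕ+, ∀ x ∈ Icc (0 : ℝ) 1, ∀ y ∈ Icc (0 : ℝ) 1,
      |S.wordDeriv l x| ≤
        C * (l.map fun i : ℕ+ => B * (i : ℝ) ^ ε).prod * |S.wordDeriv l y| := by
  obtain ⟨r, hr, hloc⟩ := S.exists_radius_deriv_ratio_le hε hB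
  obtain ⟨B', hB', hglob⟩ := S.exists_deriv_ratio_le hε
  obtain ⟨N, hN⟩ := S.exists_abs_wordDeriv_le (half_pos hr)
  have hpos : ∀ l : List ℕ+, 0 < (l.map fun i : ℕ+ => B * (i : ℝ) ^ ε).prod := fun l =>
    List.prod_pos (by
      simp only [List.mem_map]
      rintro _ ⟨i, -, rfl⟩
      have := one_le_cast i
      positivity)
  have key : ∀ l : List ℕ+, ∀ x ∈ Icc (0 : ℝ) 1, ∀ y ∈ Icc (0 : ℝ) 1,
      |S.wordDeriv l x| ≤
        B' ^ min l.length N * (l.map fun i : ℕ+ => B * (i : ℝ) ^ ε).prod * |S.wordDeriv l y| := by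
    intro l x hx y hy
    induction l with
    | nil => simp [wordDeriv]
    | cons i l ih =>
      have hx' := S.wordMap_mem l hx
      have hy' := S.wordMap_mem l hy
      have hi : (0 : ℝ) < i := zero_lt_one.trans_le (one_le_cast i)
      have hl := hpos l
      simp only [wordDeriv_cons, abs_mul, List.map_cons, List.prod_cons, List.length_cons]
      rcases lt_or_ge l.length N with h | h
      · rw [min_eq_left (by omega)]
        rw [min_eq_left h.le] at ih
        calc _ ≤ (B' * (i : ℝ) ^ ε * |S.T' i (S.wordMap l y)|) * _ :=
              mul_le_mul (hglob i _ hx' _ hy') ih (abs_nonneg _) (by positivity)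
          _ = 1 * (B' ^ (l.length + 1) * ((i : ℝ) ^ ε *
                (l.map fun i : ℕ+ => B * (i : ℝ) ^ ε).prod) *
                (|S.T' i (S.wordMap l y)| * |S.wordDeriv l y|)) := by ring
          _ ≤ B * (B' ^ (l.length + 1) * ((i : ℝ) ^ ε *
                (l.map fun i : ℕ+ => B * (i : ℝ) ^ ε).prod) *
                (|S.T' i (S.wordMap l y)| * |S.wordDeriv l y|)) := by gcongr
          _ = _ := by ring
      · rw [min_eq_right (by omega)]
        rw [min_eq_right h] at ih
        have hxy : |S.wordMap l x - S.wordMap l y| < r := by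
          have h1 := S.abs_wordMap_sub_le (hN l h) hx hy
          have h2 : |x - y| ≤ 1 := abs_le.2 ⟨by linarith [hx.1, hy.2], by linarith [hx.2, hy.1]⟩
          nlinarith
        calc _ ≤ (B * (i : ℝ) ^ ε * |S.T' i (S.wordMap l y)|) * _ :=
              mul_le_mul (hloc i _ hx' _ hy' hxy) ih (abs_nonneg _) (by positivity)
          _ = _ := by ring
  refine ⟨B' ^ N, by positivity, fun l x hx y hy => (key l x hx y hy).trans ?_⟩
  have := hpos l
  gcongr
  exact min_le_right _ _

/-- The supremum over `[0,1]` of the derivative along a word. -/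
def supDeriv (l : List ℕ+) : ℝ := sSup ((fun x => |S.wordDeriv l x|) '' Icc 0 1)

lemma supDeriv_le {l : List ℕ+} {C : ℝ} (h : ∀ x ∈ Icc (0 : ℝ) 1, |S.wordDeriv l x| ≤ C) :
    S.supDeriv l ≤ C :=
  csSup_le ((nonempty_Icc.2 zero_le_one).image _) (forall_mem_image.2 h)

lemma abs_wordDeriv_le_supDeriv (l : List ℕ+) {x : ℝ} (hx : x ∈ Icc (0 : ℝ) 1) :
    |S.wordDeriv l x| ≤ S.supDeriv l := by
  obtain ⟨Λ, hΛ, hle⟩ := S.exists_deriv_le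
  exact le_csSup ⟨Λ ^ l.length, forall_mem_image.2 fun y hy => S.abs_wordDeriv_le_pow hΛ hle l hy⟩
    (mem_image_of_mem _ hx)

lemma supDeriv_nonneg (l : List ℕ+) : 0 ≤ S.supDeriv l :=
  (abs_nonneg _).trans (S.abs_wordDeriv_le_supDeriv l (left_mem_Icc.2 zero_le_one))

lemma supDeriv_append_le (l l' : List ℕ+) :
    S.supDeriv (l ++ l') ≤ S.supDeriv l * S.supDeriv l' := by
  refine S.supDeriv_le fun x hx => ?_
  rw [wordDeriv_append, abs_mul]
  exact mul_le_mul (S.abs_wordDeriv_le_supDeriv l (S.wordMap_mem l' hx))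
    (S.abs_wordDeriv_le_supDeriv l' hx) (abs_nonneg _) (S.supDeriv_nonneg l)

lemma supDeriv_le_prod {lam : ℕ+ → ℝ}
    (h : ∀ i : ℕ+, ∀ x ∈ Icc (0 : ℝ) 1, |S.T' i x| ≤ lam i) (l : List ℕ+) :
    S.supDeriv l ≤ (l.map lam).prod := by
  refine S.supDeriv_le fun x hx => ?_
  induction l with
  | nil => simp [wordDeriv]
  | cons i l ih =>
    simp only [wordDeriv_cons, abs_mul, List.map_cons, List.prod_cons]
    have hi := h i _ (S.wordMap_mem l hx)
    exact mul_le_mul hi ih (abs_nonneg _) ((abs_nonneg _).trans hi)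

lemma diam_cyl_le_supDeriv {n : ℕ} (ω : Fin n → ℕ+) :
    diam (S.cyl ω) ≤ S.supDeriv (List.ofFn ω) := by
  refine diam_le_of_forall_dist_le (S.supDeriv_nonneg _) ?_
  rintro _ ⟨x, hx, rfl⟩ _ ⟨y, hy, rfl⟩
  have h1 := S.abs_wordMap_sub_le (fun z hz => S.abs_wordDeriv_le_supDeriv (List.ofFn ω) hz) hx hy
  have h2 : |x - y| ≤ 1 := abs_le.2 ⟨by linarith [hx.1, hy.2], by linarith [hx.2, hy.1]⟩
  exact h1.trans (mul_le_of_le_one_right (S.supDeriv_nonneg _) h2)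

lemma exists_abs_wordDeriv_le_diam_cyl {n : ℕ} (ω : Fin n → ℕ+) :
    ∃ x ∈ Icc (0 : ℝ) 1, |S.wordDeriv (List.ofFn ω) x| ≤ diam (S.cyl ω) := by
  obtain ⟨x, hx, h⟩ := exists_hasDerivAt_eq_slope (S.wordMap (List.ofFn ω))
    (S.wordDeriv (List.ofFn ω)) zero_lt_one
    (fun x hx => (S.hasDerivWithinAt_wordMap _ hx).continuousWithinAt)
    (fun x hx => (S.hasDerivWithinAt_wordMap _ (Ioo_subset_Icc_self hx)).hasDerivAt
      (Icc_mem_nhds hx.1 hx.2))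
  refine ⟨x, Ioo_subset_Icc_self hx, ?_⟩
  rw [h, sub_zero, div_one]
  have hsub : S.cyl ω ⊆ Icc 0 1 := by
    rintro _ ⟨y, hy, rfl⟩
    exact S.wordMap_mem _ hy
  exact dist_le_diam_of_mem ((isBounded_Icc 0 1).subset hsub)
    ⟨1, right_mem_Icc.2 zero_le_one, rfl⟩ ⟨0, left_mem_Icc.2 zero_le_one, rfl⟩

lemma exists_supDeriv_le_diam_cyl {ε B : ℝ} (hε : 0 < ε) (hB : 1 < B) :
    ∃ C : ℝ, 0 < C ∧ ∀ (n : ℕ) (ω : Fin n → ℕ+),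
      S.supDeriv (List.ofFn ω) ≤ C * (∏ j, B * (ω j : ℝ) ^ ε) * diam (S.cyl ω) := by
  obtain ⟨C, hC, h⟩ := S.exists_wordDeriv_ratio_le hε hB
  refine ⟨C, hC, fun n ω => S.supDeriv_le fun x hx => ?_⟩
  obtain ⟨y, hy, hyd⟩ := S.exists_abs_wordDeriv_le_diam_cyl ω
  have := h (List.ofFn ω) x hx y hy
  rw [List.map_ofFn, List.prod_ofFn] at this
  refine this.trans (mul_le_mul_of_nonneg_left hyd ?_)
  refine mul_nonneg hC.le (Finset.prod_nonneg fun j _ => ?_)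
  simp only [Function.comp_apply]
  positivity

lemma exists_pow_le_diam_cyl :
    ∃ κ : ℝ, 0 < κ ∧ ∀ n : ℕ, κ ^ n ≤ diam (S.cyl fun _ : Fin n => 1) := by
  obtain ⟨K, _, hK, -, h⟩ := S.exists_deriv_bounds zero_lt_one
  have key : ∀ n : ℕ, ∀ x ∈ Icc (0 : ℝ) 1, K ^ n ≤ |S.wordDeriv (List.replicate n 1) x| := by
    intro n x hx
    induction n with
    | zero => simp [wordDeriv]
    | succ n ih =>
      rw [List.replicate_succ, wordDeriv_cons, abs_mul, pow_succ']
      have := (h 1 _ (S.wordMap_mem (List.replicate n 1) hx)).1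
      simp only [PNat.one_coe, Nat.cast_one, Real.one_rpow, mul_one] at this
      gcongr
  refine ⟨K, hK, fun n => ?_⟩
  obtain ⟨x, hx, hxd⟩ := S.exists_abs_wordDeriv_le_diam_cyl fun _ : Fin n => 1
  rw [List.ofFn_const] at hxd
  exact (key n x hx).trans hxd

lemma hasSum_prod_pow {f : ℕ+ → ℝ} (hf : Summable f) (h0 : ∀ i, 0 ≤ f i) (n : ℕ) :
    HasSum (fun ω : Fin n → ℕ+ => ∏ j, f (ω j)) ((∑' i, f i) ^ n) := by
  induction n with
  | zero => simp
  | succ n ih =>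
    rw [← (Fin.consEquiv fun _ : Fin (n + 1) => ℕ+).hasSum_iff, pow_succ']
    have hprod : 0 ≤ fun ω : Fin n → ℕ+ => ∏ j, f (ω j) := fun ω =>
      Finset.prod_nonneg fun j _ => h0 (ω j)
    have hmul := hf.mul_of_nonneg ih.summable h0 hprod
    have := hf.hasSum.mul ih hmul
    have e : (fun ω : Fin (n + 1) → ℕ+ => ∏ j, f (ω j)) ∘ Fin.consEquiv (fun _ => ℕ+) =
        fun p => f p.1 * ∏ j, f (p.2 j) := by
      ext p
      simp [Fin.prod_univ_succ]
    rwa [e]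

lemma exists_summable_deriv_bound {s : ℝ} (hs : 1 / d < s) :
    ∃ (lam : ℕ+ → ℝ) (q : ℝ), 0 < q ∧ (∀ i : ℕ+, ∀ x ∈ Icc (0 : ℝ) 1, |S.T' i x| ≤ lam i) ∧
      Summable fun i : ℕ+ => (i : ℝ) ^ q * lam i ^ s := by
  have hd : 0 < d := zero_lt_one.trans S.one_lt_d
  have hs0 : 0 < s := lt_trans (by positivity) hs
  have hds : 1 < d * s := by rwa [div_lt_iff₀' hd] at hs
  obtain ⟨_, K, -, hK, h⟩ := S.exists_deriv_bounds (ε := (d * s - 1) / (4 * s))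
    (div_pos (by linarith) (by linarith))
  refine ⟨fun i => K * (i : ℝ) ^ (-(d - (d * s - 1) / (4 * s))), (d * s - 1) / 4, by linarith,
    fun i x hx => (h i x hx).2, ?_⟩
  have hsum : Summable fun k : ℕ => K ^ s * (k : ℝ) ^ (-((d * s + 1) / 2)) :=
    (Real.summable_nat_rpow.2 (by linarith)).mul_left _
  refine (hsum.comp_injective PNat.coe_injective).congr fun i => ?_
  have hi : (0 : ℝ) < i := zero_lt_one.trans_le (one_le_cast i)
  simp only [Function.comp_apply]
  rw [Real.mul_rpow hK.le (by positivity), ← Real.rpow_mul hi.le, mul_left_comm,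
    ← Real.rpow_add hi]
  congr 2
  field_simp
  ring

/-- The partition function built from the suprema of the derivatives. -/
def supZ (n : ℕ) (s : ℝ) : ℝ := ∑' ω : Fin n → ℕ+, S.supDeriv (List.ofFn ω) ^ s

lemma pos_of_one_div_lt {d : ℝ} (S : GaussLikeIFS d) {s : ℝ} (hs : 1 / d < s) : 0 < s :=
  lt_trans (one_div_pos.2 (zero_lt_one.trans S.one_lt_d)) hs

/-- The partition functions remain finite after weighting the digits by a small power. -/
lemma exists_weighted_sum_le {s : ℝ} (hs : 1 / d < s) :
    ∃ q A : ℝ, 0 < q ∧ 0 < A ∧ ∀ n : ℕ,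
      Summable (fun ω : Fin n → ℕ+ => (∏ j, (ω j : ℝ)) ^ q * S.supDeriv (List.ofFn ω) ^ s) ∧
      ∑' ω : Fin n → ℕ+, (∏ j, (ω j : ℝ)) ^ q * S.supDeriv (List.ofFn ω) ^ s ≤ A ^ n := by
  obtain ⟨lam, q, hq, hlam, hsum⟩ := S.exists_summable_deriv_bound hs
  have hs0 := S.pos_of_one_div_lt hs
  have h0 : ∀ i, 0 < lam i := fun i =>
    (S.abs_deriv_pos i (left_mem_Icc.2 zero_le_one)).trans_le (hlam i _ (left_mem_Icc.2 zero_le_one))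
  have hpos : ∀ i : ℕ+, 0 < (i : ℝ) ^ q * lam i ^ s := fun i => by
    have := one_le_cast i
    have := h0 i
    positivity
  refine ⟨q, _, hq, hsum.tsum_pos (fun i => (hpos i).le) 1 (hpos 1), fun n => ?_⟩
  have hS := hasSum_prod_pow hsum (fun i => (hpos i).le) n
  have hle : ∀ ω : Fin n → ℕ+, (∏ j, (ω j : ℝ)) ^ q * S.supDeriv (List.ofFn ω) ^ s ≤
      ∏ j, (ω j : ℝ) ^ q * lam (ω j) ^ s := fun ω => by
    have h1 := S.supDeriv_le_prod hlam (List.ofFn ω)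
    rw [List.map_ofFn, List.prod_ofFn] at h1
    rw [Finset.prod_mul_distrib, Real.finsetProd_rpow _ _ fun j _ => by positivity,
      Real.finsetProd_rpow _ _ fun j _ => (h0 _).le]
    have := S.supDeriv_nonneg (List.ofFn ω)
    gcongr
    exact h1
  have hsm := Summable.of_nonneg_of_le (fun ω => by
    have := S.supDeriv_nonneg (List.ofFn ω)
    positivity) hle hS.summable
  exact ⟨hsm, hS.tsum_eq ▸ hsm.tsum_le_tsum hle hS.summable⟩

lemma summable_supDeriv {s : ℝ} (hs : 1 / d < s) (n : ℕ) :
    Summable fun ω : Fin n → ℕ+ => S.supDeriv (List.ofFn ω) ^ s := by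
  obtain ⟨q, A, hq, -, h⟩ := S.exists_weighted_sum_le hs
  refine Summable.of_nonneg_of_le (fun ω => Real.rpow_nonneg (S.supDeriv_nonneg _) _)
    (fun ω => ?_) (h n).1
  refine le_mul_of_one_le_left (Real.rpow_nonneg (S.supDeriv_nonneg _) _)
    (Real.one_le_rpow ?_ hq.le)
  exact Finset.one_le_prod fun j _ => one_le_cast _

lemma diam_cyl_rpow_le {s : ℝ} (hs : 1 / d < s) {n : ℕ} (ω : Fin n → ℕ+) :
    diam (S.cyl ω) ^ s ≤ S.supDeriv (List.ofFn ω) ^ s :=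
  Real.rpow_le_rpow diam_nonneg (S.diam_cyl_le_supDeriv ω) (S.pos_of_one_div_lt hs).le

lemma summable_diam_cyl {s : ℝ} (hs : 1 / d < s) (n : ℕ) :
    Summable fun ω : Fin n → ℕ+ => diam (S.cyl ω) ^ s :=
  (S.summable_supDeriv hs n).of_nonneg_of_le (fun _ => Real.rpow_nonneg diam_nonneg _)
    fun ω => S.diam_cyl_rpow_le hs ω

lemma Z_le_supZ {s : ℝ} (hs : 1 / d < s) (n : ℕ) : S.Z n s ≤ S.supZ n s :=
  (S.summable_diam_cyl hs n).tsum_le_tsum (fun ω => S.diam_cyl_rpow_le hs ω)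
    (S.summable_supDeriv hs n)

lemma exists_pow_le_Z {s : ℝ} (hs : 1 / d < s) : ∃ c : ℝ, 0 < c ∧ ∀ n, c ^ n ≤ S.Z n s := by
  obtain ⟨κ, hκ, h⟩ := S.exists_pow_le_diam_cyl
  refine ⟨κ ^ s, by positivity, fun n => ?_⟩
  calc (κ ^ s) ^ n = (κ ^ n) ^ s := Real.rpow_pow_comm hκ.le _ _
    _ ≤ diam (S.cyl fun _ : Fin n => 1) ^ s :=
      Real.rpow_le_rpow (by positivity) (h n) (S.pos_of_one_div_lt hs).le
    _ ≤ S.Z n s := (S.summable_diam_cyl hs n).le_tsum _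
      fun _ _ => Real.rpow_nonneg diam_nonneg _

lemma supZ_add_le {s : ℝ} (hs : 1 / d < s) (m n : ℕ) :
    S.supZ (m + n) s ≤ S.supZ m s * S.supZ n s := by
  have hm := S.summable_supDeriv hs m
  have hn := S.summable_supDeriv hs n
  have hmn := hm.mul_of_nonneg hn (fun _ => Real.rpow_nonneg (S.supDeriv_nonneg _) _)
    (fun _ => Real.rpow_nonneg (S.supDeriv_nonneg _) _)
  rw [supZ, supZ, supZ, hm.tsum_mul_tsum hn hmn, ← (Fin.appendEquiv m n).tsum_eq]
  refine Summable.tsum_le_tsum (fun p => ?_)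
    ((Fin.appendEquiv m n).summable_iff.2 (S.summable_supDeriv hs (m + n))) hmn
  rw [← Real.mul_rpow (S.supDeriv_nonneg _) (S.supDeriv_nonneg _),
    show Fin.appendEquiv m n p = Fin.append p.1 p.2 from rfl, List.ofFn_fin_append]
  exact Real.rpow_le_rpow (S.supDeriv_nonneg _) (S.supDeriv_append_le _ _) (S.pos_of_one_div_lt hs).le

/-- The two partition functions are comparable up to a subexponential factor. -/
lemma exists_supZ_le {s : ℝ} (hs : 1 / d < s) {η : ℝ} (hη : 0 < η) :
    ∃ C : ℝ, 0 < C ∧ ∀ n : ℕ, S.supZ n s ≤ C * Real.exp (η * n) * S.Z n s := by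
  obtain ⟨q, A, hq, hA, hW⟩ := S.exists_weighted_sum_le hs
  obtain ⟨c, hc, hcZ⟩ := S.exists_pow_le_Z hs
  have hs0 := S.pos_of_one_div_lt hs
  obtain ⟨t, ht0, ht1, ht⟩ : ∃ t : ℝ, 0 < t ∧ t ≤ 1 ∧ t * Real.log (A / c) ≤ η / 2 := by
    have hD : 0 < |Real.log (A / c)| + 1 := by positivity
    refine ⟨min 1 (η / 2 / (|Real.log (A / c)| + 1)), by positivity, min_le_left _ _, ?_⟩
    calc _ ≤ min 1 (η / 2 / (|Real.log (A / c)| + 1)) * (|Real.log (A / c)| + 1) := by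
          gcongr
          linarith [le_abs_self (Real.log (A / c))]
      _ ≤ η / 2 / (|Real.log (A / c)| + 1) * (|Real.log (A / c)| + 1) := by
          gcongr
          exact min_le_right _ _
      _ = η / 2 := by field_simp
  obtain ⟨C, hC, hdist⟩ := S.exists_supDeriv_le_diam_cyl (ε := q * t / s)
    (B := Real.exp (η / 2 / s)) (by positivity) (Real.one_lt_exp_iff.2 (by positivity))
  refine ⟨2 * C ^ s, by positivity, fun n => ?_⟩
  set K : ℝ := (A / c) ^ n with hK
  have hK0 : 0 < K := by positivity
  have hKt : K ^ t ≤ Real.exp (η / 2 * n) := by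
    rw [hK, ← Real.rpow_natCast, ← Real.rpow_mul (by positivity),
      Real.rpow_def_of_pos (by positivity), Real.exp_le_exp]
    calc _ = t * Real.log (A / c) * n := by ring
      _ ≤ _ := by gcongr
  have hE : 0 < Real.exp (η / 2 * n) := Real.exp_pos _
  have hpt : ∀ ω : Fin n → ℕ+, S.supDeriv (List.ofFn ω) ^ s ≤
      C ^ s * Real.exp (η * n) *
        (diam (S.cyl ω) ^ s + K⁻¹ * ((∏ j, (ω j : ℝ)) ^ q * S.supDeriv (List.ofFn ω) ^ s)) := by
    intro ω
    set P : ℝ := ∏ j, (ω j : ℝ) with hP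
    have hP0 : 0 ≤ P := Finset.prod_nonneg fun j _ => by positivity
    have hprod : (∏ j, Real.exp (η / 2 / s) * (ω j : ℝ) ^ (q * t / s)) ^ s =
        Real.exp (η / 2 * n) * (P ^ q) ^ t := by
      rw [Finset.prod_mul_distrib, Finset.prod_const, Finset.card_univ, Fintype.card_fin,
        Real.finsetProd_rpow _ _ fun j _ => by positivity, ← hP,
        Real.mul_rpow (by positivity) (by positivity), ← Real.rpow_mul hP0, ← Real.rpow_mul hP0,
        ← Real.exp_nat_mul, ← Real.exp_mul]
      congr 2 <;> field_simp
    have hyoung : (P ^ q) ^ t ≤ Real.exp (η / 2 * n) * (1 + K⁻¹ * P ^ q) := by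
      have hx : 0 ≤ K⁻¹ * P ^ q := by positivity
      calc (P ^ q) ^ t = K ^ t * (K⁻¹ * P ^ q) ^ t := by
            rw [← Real.mul_rpow hK0.le hx, mul_inv_cancel_left₀ hK0.ne']
        _ ≤ Real.exp (η / 2 * n) * (1 + K⁻¹ * P ^ q) := by
            gcongr
            calc (K⁻¹ * P ^ q) ^ t ≤ (1 + K⁻¹ * P ^ q) ^ t := by gcongr; linarith
              _ ≤ (1 + K⁻¹ * P ^ q) ^ (1 : ℝ) :=
                Real.rpow_le_rpow_of_exponent_le (by linarith) ht1
              _ = _ := Real.rpow_one _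
    have hd0 : 0 ≤ diam (S.cyl ω) ^ s := Real.rpow_nonneg diam_nonneg _
    calc S.supDeriv (List.ofFn ω) ^ s
        ≤ (C * (∏ j, Real.exp (η / 2 / s) * (ω j : ℝ) ^ (q * t / s)) * diam (S.cyl ω)) ^ s :=
          Real.rpow_le_rpow (S.supDeriv_nonneg _) (hdist n ω) hs0.le
      _ = C ^ s * (Real.exp (η / 2 * n) * (P ^ q) ^ t) * diam (S.cyl ω) ^ s := by
          rw [Real.mul_rpow (by positivity) diam_nonneg, Real.mul_rpow hC.le (by positivity), hprod]
      _ ≤ C ^ s * (Real.exp (η / 2 * n) * (Real.exp (η / 2 * n) * (1 + K⁻¹ * P ^ q))) *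
            diam (S.cyl ω) ^ s := by gcongr
      _ = C ^ s * Real.exp (η * n) * (diam (S.cyl ω) ^ s + K⁻¹ * (P ^ q * diam (S.cyl ω) ^ s)) := by
          rw [show η * n = η / 2 * n + η / 2 * n by ring, Real.exp_add]
          ring
      _ ≤ _ := by
          gcongr
          exact S.diam_cyl_le_supDeriv ω
  have hd := S.summable_diam_cyl hs n
  have hw := (hW n).1.mul_left K⁻¹
  calc S.supZ n s ≤ _ :=
        (S.summable_supDeriv hs n).tsum_le_tsum hpt ((hd.add hw).mul_left _)
    _ = C ^ s * Real.exp (η * n) * (S.Z n s + K⁻¹ *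
          ∑' ω : Fin n → ℕ+, (∏ j, (ω j : ℝ)) ^ q * S.supDeriv (List.ofFn ω) ^ s) := by
        rw [tsum_mul_left, hd.tsum_add hw, tsum_mul_left, Z]
    _ ≤ C ^ s * Real.exp (η * n) * (S.Z n s + S.Z n s) := by
        gcongr
        calc _ ≤ K⁻¹ * A ^ n := by gcongr; exact (hW n).2
          _ = c ^ n := by rw [hK, div_pow, inv_div]; field_simp
          _ ≤ _ := hcZ n
    _ = _ := by ring

end GaussLikeIFS

/-- for every `s > 1/d` the limit `P(s) = lim_n P_n(s)` exists (and is finite). -/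
theorem pressure_limit_exists {d : ℝ} (S : GaussLikeIFS d) :
    ∀ s : ℝ, 1 / d < s →
      ∃ L : ℝ, Filter.Tendsto (fun n : ℕ => S.Pn n s) Filter.atTop (nhds L) := by
  intro s hs
  obtain ⟨c, hc, hcZ⟩ := S.exists_pow_le_Z hs
  have hZ : ∀ n, 0 < S.Z n s := fun n => (pow_pos hc n).trans_le (hcZ n)
  have hU : ∀ n, 0 < S.supZ n s := fun n => (hZ n).trans_le (S.Z_le_supZ hs n)
  have hsub : Subadditive fun n => Real.log (S.supZ n s) := fun m n => by
    rw [← Real.log_mul (hU m).ne' (hU n).ne']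
    exact Real.log_le_log (hU _) (S.supZ_add_le hs m n)
  have hbdd : BddBelow (range fun n : ℕ => Real.log (S.supZ n s) / n) := by
    refine ⟨min 0 (Real.log c), forall_mem_range.2 fun n => ?_⟩
    rcases n.eq_zero_or_pos with rfl | hn
    · simp
    · refine (min_le_right _ _).trans ((le_div_iff₀' (by positivity)).2 ?_)
      rw [← Real.log_pow]
      exact Real.log_le_log (pow_pos hc n) ((hcZ n).trans (S.Z_le_supZ hs n))
  have hlim := hsub.tendsto_lim hbdd
  have hdiff : Tendsto (fun n : ℕ => Real.log (S.supZ n s) / n - S.Pn n s) atTop (𝓝 0) := by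
    have hnonneg : ∀ n : ℕ, 0 ≤ Real.log (S.supZ n s) / n - S.Pn n s := fun n => by
      rw [GaussLikeIFS.Pn, one_div_mul_eq_div, ← sub_div]
      have := Real.log_le_log (hZ n) (S.Z_le_supZ hs n)
      exact div_nonneg (by linarith) (by positivity)
    refine tendsto_order.2 ⟨fun a ha => Eventually.of_forall fun n => ha.trans_le (hnonneg n),
      fun a ha => ?_⟩
    obtain ⟨C, hC, hle⟩ := S.exists_supZ_le hs (half_pos ha)
    filter_upwards [(tendsto_const_div_atTop_nhds_zero_nat (Real.log C)).eventually_lt_const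
      (half_pos ha), eventually_gt_atTop 0] with n hn hn0
    have hn0' : (0 : ℝ) < n := by exact_mod_cast hn0
    have h1 := Real.log_le_log (hU n) (hle n)
    rw [Real.log_mul (by positivity) (hZ n).ne', Real.log_mul hC.ne' (Real.exp_ne_zero _),
      Real.log_exp] at h1
    rw [div_lt_iff₀ hn0'] at hn
    rw [GaussLikeIFS.Pn, one_div_mul_eq_div, ← sub_div, div_lt_iff₀ hn0']
    linarith
  exact ⟨_, by simpa using hlim.sub hdiff⟩
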